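/- arXiv:1304.0733 — 2 statements merged into one kernel-verified Lean document; each statement's English description precedes it below -/
import Mathlib

section
/- For every n ≥ 3 and every k ≥ 3 there exists an R-trivial regular language L over an alphabet of exactly k letters with sc(L) = n and sc(L^R) = 2^{n-1}. -/
/-- A DFA is *partially ordered* if its reachability relation
`p ≼ q ↔ ∃ w, M.evalFrom p w = q` is antisymmetric (hence a partial order). -/
def DFA.PartiallyOrderedDFA {α σ : Type} (M : DFA α σ) : Prop :=
  ∀ p q : σ, (∃ w : List α, M.evalFrom p w = q) → (∃ w : List α, M.evalFrom q w = p) → p = q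

/-- A DFA is *minimal* if every state is reachable from the initial state and
all pairs of distinct states are distinguishable. -/
def DFA.MinimalDFA {α σ : Type} (M : DFA α σ) : Prop :=
  (∀ q : σ, ∃ w : List α, M.evalFrom M.start w = q) ∧
  (∀ p q : σ, p ≠ q →
    ∃ w : List α, ¬ (M.evalFrom p w ∈ M.accept ↔ M.evalFrom q w ∈ M.accept))

/-- The *state complexity* of a language: the least number of states of a
(complete, deterministic) finite automaton accepting it. -/
noncomputable def stateComplexity {α : Type} (L : Language α) : ℕ :=
  sInf {n : ℕ | ∃ M : DFA α (Fin n), M.accepts = L}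

/-- A regular language is *R-trivial* iff its minimal DFA is partially ordered. -/
def IsRTrivial {α : Type} (L : Language α) : Prop :=
  ∃ (n : ℕ) (M : DFA α (Fin n)), M.MinimalDFA ∧ M.accepts = L ∧ M.PartiallyOrderedDFA

/-- A regular language is *J-trivial* iff the minimal DFAs of both the language
and its reverse are partially ordered. -/
def IsJTrivial {α : Type} (L : Language α) : Prop :=
  IsRTrivial L ∧ IsRTrivial L.reverse

/-- A *dead state*: a non-accepting state with a self-loop under every letter. -/
def DFA.DeadState {α σ : Type} (M : DFA α σ) (d : σ) : Prop :=
  d ∉ M.accept ∧ ∀ a : α, M.step d a = d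

theorem DFA.exists_fin_accepts_eq {α σ : Type} [Fintype σ] (M : DFA α σ) :
    ∃ N : DFA α (Fin (Fintype.card σ)), N.accepts = M.accepts :=
  ⟨DFA.reindex (Fintype.equivFin σ) M, by simp⟩

theorem DFA.MinimalDFA.card_le {α σ τ : Type} [Fintype σ] [Fintype τ] {M : DFA α σ}
    (hM : M.MinimalDFA) (N : DFA α τ) (h : N.accepts = M.accepts) :
    Fintype.card σ ≤ Fintype.card τ := by
  choose w hw using hM.1
  refine Fintype.card_le_of_injective (fun q => N.eval (w q)) fun p q hpq => ?_
  by_contra hne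
  obtain ⟨u, hu⟩ := hM.2 p q hne
  have key : ∀ r, M.evalFrom r u ∈ M.accept ↔ N.evalFrom (N.eval (w r)) u ∈ N.accept := by
    intro r
    have h1 : w r ++ u ∈ N.accepts ↔ w r ++ u ∈ M.accepts := by rw [h]
    rw [DFA.mem_accepts, DFA.mem_accepts, DFA.eval, DFA.eval, DFA.evalFrom_of_append,
      DFA.evalFrom_of_append, hw r] at h1
    exact h1.symm
  apply hu
  rw [key p, key q]
  simp only at hpq
  rw [hpq]

theorem DFA.MinimalDFA.stateComplexity_eq {α σ : Type} [Fintype σ] {M : DFA α σ}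
    (hM : M.MinimalDFA) : stateComplexity M.accepts = Fintype.card σ := by
  refine le_antisymm (Nat.sInf_le M.exists_fin_accepts_eq) ?_
  refine le_csInf ⟨_, M.exists_fin_accepts_eq⟩ ?_
  rintro m ⟨N, hN⟩
  simpa using hM.card_le N hN

/-- The family of sets of states from which some fixed word is accepted. -/
def DFA.wordPreimages {α σ : Type} (M : DFA α σ) : Set (Set σ) :=
  {S | ∃ w : List α, {q | M.evalFrom q w ∈ M.accept} = S}

/-- The determinized reverse of `M`, restricted to its reachable states. -/
def DFA.reverseDFA {α σ : Type} (M : DFA α σ) : DFA α M.wordPreimages where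
  step S a := ⟨{q | M.step q a ∈ S.1}, by
    obtain ⟨S, w, rfl⟩ := S
    exact ⟨a :: w, rfl⟩⟩
  start := ⟨M.accept, [], rfl⟩
  accept := {S | M.start ∈ S.1}

theorem DFA.mem_evalFrom_reverseDFA {α σ : Type} (M : DFA α σ) (w : List α)
    (S : M.wordPreimages) (q : σ) :
    q ∈ (M.reverseDFA.evalFrom S w).1 ↔ M.evalFrom q w.reverse ∈ S.1 := by
  induction w generalizing S with
  | nil => rfl
  | cons a w ih =>
    rw [DFA.evalFrom_cons, ih, List.reverse_cons, DFA.evalFrom_of_append]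
    rfl

theorem DFA.accepts_reverseDFA {α σ : Type} (M : DFA α σ) :
    M.reverseDFA.accepts = M.accepts.reverse := by
  ext w
  rw [Language.mem_reverse]
  exact M.mem_evalFrom_reverseDFA w _ M.start

theorem DFA.minimalDFA_reverseDFA {α σ : Type} (M : DFA α σ)
    (hM : ∀ q : σ, ∃ w : List α, M.evalFrom M.start w = q) : M.reverseDFA.MinimalDFA := by
  constructor
  · rintro ⟨S, w, rfl⟩
    refine ⟨w.reverse, Subtype.ext (Set.ext fun q => ?_)⟩
    rw [M.mem_evalFrom_reverseDFA, List.reverse_reverse]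
    rfl
  · intro S T hST
    by_contra! h
    refine hST (Subtype.ext (Set.ext fun q => ?_))
    obtain ⟨w, hw⟩ := hM q
    have key : ∀ U : M.wordPreimages,
        M.reverseDFA.evalFrom U w.reverse ∈ M.reverseDFA.accept ↔ q ∈ U.1 := by
      intro U
      have := M.mem_evalFrom_reverseDFA w.reverse U M.start
      rwa [List.reverse_reverse, hw] at this
    rw [← key S, ← key T]
    exact h w.reverse

theorem DFA.stateComplexity_reverse {α σ : Type} [Finite σ] (M : DFA α σ)
    (hM : ∀ q : σ, ∃ w : List α, M.evalFrom M.start w = q) :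
    stateComplexity M.accepts.reverse = M.wordPreimages.ncard := by
  have : Fintype M.wordPreimages := Fintype.ofFinite _
  rw [← M.accepts_reverseDFA, (M.minimalDFA_reverseDFA hM).stateComplexity_eq,
    ← Nat.card_eq_fintype_card, Nat.card_coe_set_eq]

theorem DFA.partiallyOrderedDFA_of_le_step {α σ : Type} [PartialOrder σ] (M : DFA α σ)
    (hM : ∀ q a, q ≤ M.step q a) : M.PartiallyOrderedDFA := by
  have key : ∀ (w : List α) (q : σ), q ≤ M.evalFrom q w := by
    intro w
    induction w with
    | nil => exact fun q => le_rfl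
    | cons a w ih => exact fun q => (hM q a).trans (ih _)
  rintro p q ⟨u, rfl⟩ ⟨v, hv⟩
  exact le_antisymm (key u p) ((key v _).trans hv.le)

/-- Letters `0` and `1` shift the states `0, …, m` upwards and send `m` to `m + 1`
and `m + 2` respectively; all other letters only move `m + 1` to `m + 2`. -/
def shiftDFA (k m : ℕ) : DFA (Fin k) (Fin (m + 3)) where
  step q a :=
    if a.val = 0 then if h : q.val ≤ m then ⟨q.val + 1, by omega⟩ else q
    else if a.val = 1 then
      if h : q.val < m then ⟨q.val + 1, by omega⟩
      else if q.val = m then Fin.last (m + 2) else q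
    else if q.val = m + 1 then Fin.last (m + 2) else q
  start := 0
  accept := {q | q.val = m + 1}

theorem le_shiftDFA_step {k m : ℕ} (q : Fin (m + 3)) (a : Fin k) :
    q ≤ (shiftDFA k m).step q a := by
  rw [Fin.le_def]
  simp only [shiftDFA]
  split_ifs <;> simp <;> omega

theorem shiftDFA_reachable {k m : ℕ} (hk : 3 ≤ k) (q : Fin (m + 3)) :
    ∃ w : List (Fin k), (shiftDFA k m).evalFrom (shiftDFA k m).start w = q := by
  obtain ⟨i, hi⟩ := q
  induction i with
  | zero => exact ⟨[], rfl⟩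
  | succ i ih =>
    obtain ⟨w, hw⟩ := ih (by omega)
    by_cases h : i ≤ m
    · refine ⟨w ++ [⟨0, by omega⟩], ?_⟩
      rw [DFA.evalFrom_append_singleton, hw]
      simp [shiftDFA, h]
    · refine ⟨w ++ [⟨2, by omega⟩], ?_⟩
      obtain rfl : i = m + 1 := by omega
      rw [DFA.evalFrom_append_singleton, hw]
      simp [shiftDFA, Fin.ext_iff]

theorem shiftDFA_evalFrom_last {k m : ℕ} (w : List (Fin k)) :
    (shiftDFA k m).evalFrom (Fin.last (m + 2)) w = Fin.last (m + 2) := by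
  induction w with
  | nil => rfl
  | cons a w ih =>
    rw [DFA.evalFrom_cons, show (shiftDFA k m).step (Fin.last (m + 2)) a = Fin.last (m + 2) by
      simp [shiftDFA], ih]

theorem shiftDFA_exists_word_upper {k m : ℕ} (hk : 3 ≤ k) (j : ℕ) (X : ℕ → Prop) :
    ∃ w : List (Fin k), ∀ q : Fin (m + 3), m + 1 ≤ q.val + j → q.val < m + 2 →
      ((shiftDFA k m).evalFrom q w ∈ (shiftDFA k m).accept ↔ q.val = m + 1 ∨ X q.val) := by
  induction j generalizing X with
  | zero =>
    refine ⟨[], fun q h1 h2 => ?_⟩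
    have hq : q.val = m + 1 := by omega
    simp [shiftDFA, hq]
  | succ j ih =>
    obtain ⟨w, hw⟩ := ih fun i => X (i - 1)
    by_cases hX : X m
    · refine ⟨⟨0, by omega⟩ :: w, fun q h1 h2 => ?_⟩
      rw [DFA.evalFrom_cons]
      by_cases hq : q.val ≤ m
      · have hstep : (shiftDFA k m).step q ⟨0, by omega⟩ = ⟨q.val + 1, by omega⟩ := by
          simp [shiftDFA, hq]
        rw [hstep, hw _ (by simp only; omega) (by simp only; omega)]
        grind
      · have hstep : (shiftDFA k m).step q ⟨0, by omega⟩ = q := by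
          simp [shiftDFA, hq]
        rw [hstep, hw _ (by omega) h2]
        grind
    · refine ⟨⟨1, by omega⟩ :: w, fun q h1 h2 => ?_⟩
      rw [DFA.evalFrom_cons]
      rcases lt_trichotomy q.val m with hq | hq | hq
      · have hstep : (shiftDFA k m).step q ⟨1, by omega⟩ = ⟨q.val + 1, by omega⟩ := by
          simp [shiftDFA, hq]
        rw [hstep, hw _ (by simp only; omega) (by simp only; omega)]
        grind
      · have hstep : (shiftDFA k m).step q ⟨1, by omega⟩ = Fin.last (m + 2) := by
          simp [shiftDFA, hq]
        rw [hstep, shiftDFA_evalFrom_last]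
        simp [shiftDFA, hq, hX]
      · have hstep : (shiftDFA k m).step q ⟨1, by omega⟩ = q := by
          simp [shiftDFA, hq.ne', hq.le]
        rw [hstep, hw _ (by omega) h2]
        grind

theorem shiftDFA_wordPreimages {k m : ℕ} (hk : 3 ≤ k) :
    (shiftDFA k m).wordPreimages = {S | Fin.last (m + 2) ∉ S} := by
  ext S
  constructor
  · rintro ⟨w, rfl⟩
    rw [Set.mem_ofPred_eq, Set.mem_ofPred_eq, shiftDFA_evalFrom_last]
    simp [shiftDFA]
  · intro hS
    rw [Set.mem_ofPred_eq] at hS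
    obtain ⟨w, hw⟩ := shiftDFA_exists_word_upper (m := m) hk (m + 1)
      fun i => ∃ h : i < m + 3, (⟨i, h⟩ : Fin (m + 3)) ∈ S
    have hX : ∀ q : Fin (m + 3), (∃ h : q.val < m + 3, (⟨q.val, h⟩ : Fin (m + 3)) ∈ S) ↔ q ∈ S :=
      fun q => ⟨fun ⟨_, h⟩ => h, fun h => ⟨q.isLt, h⟩⟩
    have hlast : ∀ v : List (Fin k),
        (shiftDFA k m).evalFrom (Fin.last (m + 2)) v ∉ (shiftDFA k m).accept := by
      intro v
      rw [shiftDFA_evalFrom_last]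
      simp [shiftDFA]
    by_cases h1 : (⟨m + 1, by omega⟩ : Fin (m + 3)) ∈ S
    · refine ⟨w, Set.ext fun q => ?_⟩
      rw [Set.mem_ofPred_eq]
      rcases Fin.eq_castSucc_or_eq_last q with ⟨p, rfl⟩ | rfl
      · rw [hw _ (by omega) p.isLt, hX, or_iff_right_iff_imp]
        intro hp
        rwa [show p.castSucc = ⟨m + 1, by omega⟩ from Fin.ext hp]
      · exact iff_of_false (hlast w) hS
    · refine ⟨⟨2, by omega⟩ :: w, Set.ext fun q => ?_⟩
      rw [Set.mem_ofPred_eq]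
      rcases Fin.eq_castSucc_or_eq_last q with ⟨p, rfl⟩ | rfl
      · rw [DFA.evalFrom_cons]
        by_cases hp : p.castSucc = ⟨m + 1, by omega⟩
        · rw [hp, show (shiftDFA k m).step ⟨m + 1, by omega⟩ ⟨2, by omega⟩ = Fin.last (m + 2) by
            simp [shiftDFA]]
          exact iff_of_false (hlast w) h1
        · have hp' : p.castSucc.val ≠ m + 1 := fun h => hp (Fin.ext h)
          rw [show (shiftDFA k m).step p.castSucc ⟨2, by omega⟩ = p.castSucc by
            simpa [shiftDFA] using fun h => absurd h hp',
            hw _ (by omega) p.isLt, hX, or_iff_right hp']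
      · exact iff_of_false (hlast _) hS

theorem statement10 (n k : ℕ) (hn : 3 ≤ n) (hk : 3 ≤ k) :
    ∃ L : Language (Fin k), IsRTrivial L ∧ stateComplexity L = n ∧
      stateComplexity L.reverse = 2 ^ (n - 1) := by
  obtain ⟨m, rfl⟩ : ∃ m, n = m + 3 := ⟨n - 3, by omega⟩
  have hmin : (shiftDFA k m).MinimalDFA := by
    refine ⟨shiftDFA_reachable hk, ?_⟩
    have key : ∀ p q : Fin (m + 3), p < q → ∃ w : List (Fin k),
        ¬ ((shiftDFA k m).evalFrom p w ∈ (shiftDFA k m).accept ↔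
          (shiftDFA k m).evalFrom q w ∈ (shiftDFA k m).accept) := by
      intro p q hpq
      have hp : ({p} : Set (Fin (m + 3))) ∈ (shiftDFA k m).wordPreimages := by
        rw [shiftDFA_wordPreimages hk]
        exact (hpq.trans_le (Fin.le_last q)).ne'
      obtain ⟨w, hw⟩ := hp
      have h : ∀ r, (shiftDFA k m).evalFrom r w ∈ (shiftDFA k m).accept ↔ r = p :=
        fun r => Set.ext_iff.1 hw r
      exact ⟨w, by simp [h, hpq.ne']⟩
    intro p q hpq
    rcases hpq.lt_or_gt with h | h
    · exact key p q h
    · obtain ⟨w, hw⟩ := key q p h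
      exact ⟨w, fun hiff => hw hiff.symm⟩
  refine ⟨(shiftDFA k m).accepts,
    ⟨m + 3, shiftDFA k m, hmin, rfl, DFA.partiallyOrderedDFA_of_le_step _ le_shiftDFA_step⟩,
    by rw [hmin.stateComplexity_eq, Fintype.card_fin], ?_⟩
  rw [DFA.stateComplexity_reverse _ (shiftDFA_reachable hk), shiftDFA_wordPreimages hk,
    show {S : Set (Fin (m + 3)) | Fin.last (m + 2) ∉ S} = 𝒫 {Fin.last (m + 2)}ᶜ by
      ext S; simp [Set.subset_compl_singleton_iff],
    Set.ncard_powerset, Set.ncard_compl]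
  simp
end

section
/- Let L be a J-trivial regular language over a finite alphabet Σ with sc(L) = n. If sc(L^R) = 2^{n-1}, then |Σ| ≥ n - 1. Equivalently, every J-trivial regular language L with sc(L) = n over an alphabet with at most n - 2 letters satisfies sc(L^R) < 2^{n-1}. -/
namespace DFA

variable {α σ τ : Type}

/-- In a finite partially ordered DFA, every transition that is not a loop strictly decreases
the number of reachable states. -/
theorem PartiallyOrderedDFA.exists_rank [Finite σ] {M : DFA α σ} (hM : M.PartiallyOrderedDFA) :
    ∃ h : σ → ℕ, ∀ q a, M.step q a ≠ q → h (M.step q a) < h q := by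
  refine ⟨fun q => {p | ∃ w, M.evalFrom q w = p}.ncard, fun q a hq => ?_⟩
  refine Set.ncard_lt_ncard ?_ (Set.toFinite _)
  refine (Set.ssubset_iff_of_subset ?_).2 ⟨q, ⟨[], rfl⟩, ?_⟩
  · rintro p ⟨w, rfl⟩
    exact ⟨a :: w, rfl⟩
  · rintro ⟨w, hw⟩
    exact hq (hM _ _ ⟨w, hw⟩ ⟨[a], rfl⟩)

theorem MinimalDFA.card_le_s11 [Finite τ] {M : DFA α σ} (hM : M.MinimalDFA) {P : DFA α τ}
    (hP : P.accepts = M.accepts) : Nat.card σ ≤ Nat.card τ := by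
  choose u hu using hM.1
  have key (q : σ) (w : List α) :
      M.evalFrom q w ∈ M.accept ↔ P.evalFrom (P.evalFrom P.start (u q)) w ∈ P.accept := by
    rw [← evalFrom_of_append]
    nth_rw 1 [← hu q]
    rw [← evalFrom_of_append]
    change u q ++ w ∈ M.accepts ↔ u q ++ w ∈ P.accepts
    rw [hP]
  refine Nat.card_le_card_of_injective (fun q => P.evalFrom P.start (u q)) fun p q hpq => ?_
  by_contra hne
  obtain ⟨w, hw⟩ := hM.2 p q hne
  refine hw ?_
  rw [key, key]
  simp only at hpq
  rw [hpq]

theorem MinimalDFA.stateComplexity_eq_s11 {n : ℕ} {M : DFA α (Fin n)} (hM : M.MinimalDFA) :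
    stateComplexity M.accepts = n := by
  refine le_antisymm (Nat.sInf_le ⟨M, rfl⟩) ?_
  obtain ⟨P, hP⟩ := Nat.sInf_mem (s := {n | ∃ P : DFA α (Fin n), P.accepts = M.accepts})
    ⟨n, M, rfl⟩
  have h := hM.card_le_s11 hP
  rwa [Nat.card_fin, Nat.card_fin] at h

/-- The words `x` and `y` are accepted from the same states of `M` as soon as their
reverses lead to the same state of an automaton for the reverse language. -/
theorem evalFrom_mem_accept_iff_of_reverse {M : DFA α σ} {N : DFA α τ}
    (hM : ∀ q, ∃ w, M.evalFrom M.start w = q) (hN : N.accepts = M.accepts.reverse)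
    {x y : List α} (hxy : N.eval x.reverse = N.eval y.reverse) (q : σ) :
    M.evalFrom q x ∈ M.accept ↔ M.evalFrom q y ∈ M.accept := by
  obtain ⟨u, rfl⟩ := hM q
  have key (z : List α) : M.evalFrom (M.evalFrom M.start u) z ∈ M.accept ↔
      N.evalFrom (N.eval z.reverse) u.reverse ∈ N.accept := by
    rw [eval, ← evalFrom_of_append, ← evalFrom_of_append, ← List.reverse_append]
    change u ++ z ∈ M.accepts ↔ (u ++ z).reverse ∈ N.accepts
    rw [hN, Language.mem_reverse, List.reverse_reverse]
  rw [key, key, hxy]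

/-- If the reverse language has a partially ordered DFA, then two successors of a state under
letters `a` and `c` coincide as soon as both are fixed by `a` and `c`. -/
theorem eq_of_step_fixed [Finite τ] {M : DFA α σ} {N : DFA α τ}
    (hM : M.MinimalDFA) (hN : N.accepts = M.accepts.reverse) (hpo : N.PartiallyOrderedDFA)
    {s : σ} {a c : α}
    (haa : M.step (M.step s a) a = M.step s a) (hac : M.step (M.step s a) c = M.step s a)
    (hca : M.step (M.step s c) a = M.step s c) (hcc : M.step (M.step s c) c = M.step s c) :
    M.step s a = M.step s c := by
  obtain ⟨h, hh⟩ := hpo.exists_rank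
  have key : ∀ k x, h (N.eval x.reverse) = k →
      (M.evalFrom (M.step s a) x ∈ M.accept ↔ M.evalFrom (M.step s c) x ∈ M.accept) := by
    intro k
    induction k using Nat.strong_induction_on with
    | _ k ih =>
      rintro x rfl
      have hcons (b : α) : N.eval (b :: x).reverse = N.step (N.eval x.reverse) b := by
        rw [List.reverse_cons, eval_append_singleton]
      by_cases ha : N.step (N.eval x.reverse) a = N.eval x.reverse
      · by_cases hc : N.step (N.eval x.reverse) c = N.eval x.reverse
        · have h1 := evalFrom_mem_accept_iff_of_reverse hM.1 hN ((hcons a).trans ha) s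
          have h2 := evalFrom_mem_accept_iff_of_reverse hM.1 hN ((hcons c).trans hc) s
          exact h1.trans h2.symm
        · have := ih _ (hh _ _ hc) (c :: x) (by rw [hcons])
          simpa only [evalFrom_cons, hac, hcc] using this
      · have := ih _ (hh _ _ ha) (a :: x) (by rw [hcons])
        simpa only [evalFrom_cons, haa, hca] using this
  by_contra hne
  obtain ⟨w, hw⟩ := hM.2 _ _ hne
  exact hw (key _ w rfl)

/-- With too few letters, some set of states agreeing with the accepting states on a sink is not
of the form `{q | M.evalFrom q x ∈ M.accept}`. -/
theorem exists_set_ne_evalFrom_mem_accept [Fintype α] [Fintype σ] [Finite τ]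
    {M : DFA α σ} {N : DFA α τ}
    (hM : M.MinimalDFA) (hMpo : M.PartiallyOrderedDFA)
    (hN : N.accepts = M.accepts.reverse) (hNpo : N.PartiallyOrderedDFA)
    (hcard : Fintype.card α + 1 < Fintype.card σ) (z : σ) (hz : ∀ a, M.step z a = z) :
    ∃ C : Set σ, (z ∈ C ↔ z ∈ M.accept) ∧ ∀ x, C ≠ {q | M.evalFrom q x ∈ M.accept} := by
  classical
  obtain ⟨h, hh⟩ := hMpo.exists_rank
  have hs (a : α) : ∃ s, (∃ q, M.step q a ≠ q) →
      M.step s a ≠ s ∧ ∀ q, M.step q a ≠ q → h s ≤ h q := by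
    by_cases ha : ∃ q, M.step q a ≠ q
    · obtain ⟨s, hs, hmin⟩ :=
        Set.exists_min_image {q | M.step q a ≠ q} h (Set.toFinite _) ha
      exact ⟨s, fun _ => ⟨hs, hmin⟩⟩
    · exact ⟨z, fun h => absurd h ha⟩
  choose s hs using hs
  have hfix (a : α) (ha : ∃ q, M.step q a ≠ q) (q : σ) (hq : h q < h (s a)) :
      M.step q a = q := by
    by_contra hne
    exact absurd ((hs a ha).2 q hne) (not_le.2 hq)
  obtain ⟨e, he⟩ : ∃ e, e ∉ insert z (Finset.univ.image s) := by
    by_contra! hall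
    have h1 := Finset.card_le_card (fun q _ => hall q : Finset.univ ⊆ _)
    have h2 := Finset.card_insert_le z (Finset.univ.image s)
    have h3 := Finset.card_image_le (s := Finset.univ) (f := s)
    rw [Finset.card_univ] at h1 h3
    omega
  simp only [Finset.mem_insert, Finset.mem_image, Finset.mem_univ, true_and, not_or,
    not_exists] at he
  let E (q : σ) (a : α) : Prop := s a = q ∧ M.step q a ≠ q
  have hEeq {q : σ} {a c : α} (ha : E q a) (hc : E q c) : M.step q a = M.step q c := by
    obtain ⟨ha, ha'⟩ := ha
    obtain ⟨hc, hc'⟩ := hc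
    have fa := hfix a ⟨_, ha'⟩
    have fc := hfix c ⟨_, hc'⟩
    rw [ha] at fa
    rw [hc] at fc
    exact eq_of_step_fixed hM hN hNpo (fa _ (hh _ _ ha')) (fc _ (hh _ _ ha'))
      (fa _ (hh _ _ hc')) (fc _ (hh _ _ hc'))
  let step (q : σ) (rec : ∀ p, h p < h q → Prop) : Prop :=
    if hq : ∃ a, E q a then
      ¬ rec (M.step q hq.choose) (hh _ _ hq.choose_spec.2)
    else if q = z then q ∈ M.accept else q ∉ M.accept
  let wf : WellFounded (fun p q : σ => h p < h q) := (measure h).wf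
  let C : σ → Prop := wf.fix step
  have hC (q : σ) : C q = step q (fun p _ => C p) := wf.fix_eq step q
  have hCe : ∀ q a, E q a → (C q ↔ ¬ C (M.step q a)) := by
    intro q a ha
    have hex : ∃ a, E q a := ⟨a, ha⟩
    rw [hC q, hEeq ha hex.choose_spec]
    simp only [step, dif_pos hex]
  have hzC : C z ↔ z ∈ M.accept := by
    have hex : ¬ ∃ a, E z a := fun ⟨a, ha⟩ => ha.2 (hz a)
    rw [hC z]
    simp only [step, dif_neg hex, if_true]
  have heC : C e ↔ e ∉ M.accept := by
    have hex : ¬ ∃ a, E e a := fun ⟨a, ha⟩ => he.2 a ha.1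
    rw [hC e]
    simp only [step, dif_neg hex, if_neg he.1]
  refine ⟨{q | C q}, hzC, fun x hx => ?_⟩
  have hx' (q : σ) : C q ↔ M.evalFrom q x ∈ M.accept := Set.ext_iff.1 hx q
  clear hx
  induction x with
  | nil =>
    have := hx' e
    rw [heC, evalFrom_nil] at this
    tauto
  | cons a x ih =>
    by_cases ha : ∃ q, M.step q a ≠ q
    · have h1 := (hs a ha).1
      have h2 := hCe (s a) a ⟨rfl, h1⟩
      rw [hx', hx', evalFrom_cons, evalFrom_cons, hfix a ha _ (hh _ _ h1)] at h2
      tauto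
    · push Not at ha
      exact ih fun q => by rw [hx' q, evalFrom_cons, ha q]

theorem card_lt_two_pow_of_reverse [Fintype α] [Fintype σ] [Finite τ]
    {M : DFA α σ} {N : DFA α τ}
    (hM : M.MinimalDFA) (hMpo : M.PartiallyOrderedDFA) (hNmin : N.MinimalDFA)
    (hN : N.accepts = M.accepts.reverse) (hNpo : N.PartiallyOrderedDFA)
    (hcard : Fintype.card α + 1 < Fintype.card σ) :
    Nat.card τ < 2 ^ (Fintype.card σ - 1) := by
  classical
  have := Fintype.ofFinite τ
  obtain ⟨h, hh⟩ := hMpo.exists_rank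
  have : Nonempty σ := ⟨M.start⟩
  obtain ⟨z, hzmin⟩ := Finite.exists_min h
  have hz (a : α) : M.step z a = z := by
    by_contra hne
    exact absurd (hzmin _) (not_le.2 (hh _ _ hne))
  obtain ⟨C, hzC, hC⟩ := exists_set_ne_evalFrom_mem_accept hM hMpo hN hNpo hcard z hz
  have hzx (x : List α) : M.evalFrom z x = z := by
    induction x with
    | nil => rfl
    | cons a x ih => rw [evalFrom_cons, hz, ih]
  choose y hy using hNmin.1
  have hy' (t : τ) : N.eval (y t).reverse.reverse = t := by
    rw [List.reverse_reverse]; exact hy t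
  have key (t : τ) (v : List α) : N.evalFrom t v ∈ N.accept ↔
      M.evalFrom (M.eval v.reverse) (y t).reverse ∈ M.accept := by
    nth_rw 1 [← hy t]
    rw [eval, ← evalFrom_of_append, ← evalFrom_of_append, ← List.reverse_append]
    change y t ++ v ∈ N.accepts ↔ (y t ++ v).reverse ∈ M.accepts
    rw [hN, Language.mem_reverse]
  let g (t : τ) : Set {q // q ≠ z} := {q | M.evalFrom q.1 (y t).reverse ∈ M.accept}
  have hg : Function.Injective g := by
    intro t t' htt
    by_contra hne
    obtain ⟨v, hv⟩ := hNmin.2 t t' hne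
    refine hv ?_
    rw [key, key]
    by_cases hq : M.eval v.reverse = z
    · rw [hq, hzx, hzx]
    · exact Set.ext_iff.1 htt ⟨_, hq⟩
  have hns : ¬ Function.Surjective g := by
    intro hsurj
    obtain ⟨t, ht⟩ := hsurj {q | q.1 ∈ C}
    refine hC (y t).reverse (Set.ext fun q => ?_)
    by_cases hq : q = z
    · rw [hq, hzC, Set.mem_ofPred_eq, hzx]
    · exact (Set.ext_iff.1 ht ⟨q, hq⟩).symm
  have hlt := Fintype.card_lt_of_injective_not_surjective g hg hns
  rw [Fintype.card_set] at hlt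
  rw [Nat.card_eq_fintype_card]
  simpa [Fintype.card_subtype_compl] using hlt

end DFA

theorem statement11 {α : Type} [Fintype α] [Nonempty α] (L : Language α) (n : ℕ)
    (hJ : IsJTrivial L) (hsc : stateComplexity L = n) :
    (stateComplexity L.reverse = 2 ^ (n - 1) → n - 1 ≤ Fintype.card α) ∧
    (Fintype.card α ≤ n - 2 → stateComplexity L.reverse < 2 ^ (n - 1)) := by
  obtain ⟨⟨m, M, hM, rfl, hMpo⟩, ⟨k, N, hNmin, hN, hNpo⟩⟩ := hJ
  obtain rfl : m = n := hM.stateComplexity_eq_s11.symm.trans hsc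
  have hlt (hcard : Fintype.card α + 1 < m) :
      stateComplexity M.accepts.reverse < 2 ^ (m - 1) := by
    rw [← hN, hNmin.stateComplexity_eq_s11]
    simpa using DFA.card_lt_two_pow_of_reverse hM hMpo hNmin hN hNpo (by simpa using hcard)
  have hpos : 0 < Fintype.card α := Fintype.card_pos
  refine ⟨fun heq => ?_, fun hcard => hlt (by omega)⟩
  by_contra hcard
  exact (hlt (by omega)).ne heq
end
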